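/- Let (x, y) and (x', y') be two pairs of linearly independent vectors in ℝ³ such that ‖x‖ = ‖x'‖, ‖y‖ = ‖y'‖, and ⟨x, y⟩ = ⟨x', y'⟩. Then there exists a unique g ∈ SO(3) with g x = x' and g y = y'. (Every nondegenerate triangle in ℝ³ is the image of a congruent reference triangle by a unique rotation.) -/

import Mathlib

open Matrix
open scoped RealInnerProductSpace

noncomputable section

/-- `g` is a special orthogonal `n × n` real matrix: `gᵀ g = 1` and `det g = 1`. -/
def IsSO (n : ℕ) (g : Matrix (Fin n) (Fin n) ℝ) : Prop :=
  g.transpose * g = 1 ∧ g.det = 1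

/-- The matrix with rows `u`, `v` and `u ⨯₃ v`. -/
def crossFrame (u v : Fin 3 → ℝ) : Matrix (Fin 3) (Fin 3) ℝ :=
  Matrix.of ![u, v, u ⨯₃ v]

lemma crossFrame_det (u v : Fin 3 → ℝ) :
    (crossFrame u v).det = (u ⬝ᵥ u) * (v ⬝ᵥ v) - (u ⬝ᵥ v) * (v ⬝ᵥ u) := by
  rw [← cross_dot_cross]
  simp [crossFrame, det_fin_three, cross_apply, dotProduct, Fin.sum_univ_three]
  ring

lemma crossFrame_det_ne_zero {u v : Fin 3 → ℝ} (h : LinearIndependent ℝ ![u, v]) :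
    (crossFrame u v).det ≠ 0 := by
  rw [crossFrame_det, ← cross_dot_cross]
  exact fun h0 => crossProduct_ne_zero_iff_linearIndependent.2 h (dotProduct_self_eq_zero.1 h0)

lemma crossFrame_mul_transpose (u v : Fin 3 → ℝ) :
    crossFrame u v * (crossFrame u v)ᵀ =
      !![u ⬝ᵥ u, u ⬝ᵥ v, 0; u ⬝ᵥ v, v ⬝ᵥ v, 0; 0, 0,
        (u ⬝ᵥ u) * (v ⬝ᵥ v) - (u ⬝ᵥ v) * (u ⬝ᵥ v)] := by
  ext i j
  fin_cases i <;> fin_cases j <;>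
    simp [crossFrame, mul_apply, cross_apply, dotProduct, Fin.sum_univ_three] <;> ring

lemma transpose_mulVec_cross_mulVec (g : Matrix (Fin 3) (Fin 3) ℝ) (u v : Fin 3 → ℝ) :
    gᵀ *ᵥ ((g *ᵥ u) ⨯₃ (g *ᵥ v)) = g.det • (u ⨯₃ v) := by
  ext i
  fin_cases i <;>
    simp [mulVec, det_fin_three, cross_apply, dotProduct, Fin.sum_univ_three] <;> ring

lemma IsSO.mulVec_cross {g : Matrix (Fin 3) (Fin 3) ℝ} (hg : IsSO 3 g) (u v : Fin 3 → ℝ) :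
    g *ᵥ (u ⨯₃ v) = (g *ᵥ u) ⨯₃ (g *ᵥ v) := by
  have h := transpose_mulVec_cross_mulVec g u v
  rw [hg.2, one_smul] at h
  rw [← h, mulVec_mulVec, mul_eq_one_comm.1 hg.1, one_mulVec]

lemma IsSO.crossFrame_mul_transpose {g : Matrix (Fin 3) (Fin 3) ℝ} (hg : IsSO 3 g)
    (u v : Fin 3 → ℝ) : crossFrame u v * gᵀ = crossFrame (g *ᵥ u) (g *ᵥ v) := by
  have h (w : Fin 3 → ℝ) (j : Fin 3) : w ⬝ᵥ (fun k => g j k) = (g *ᵥ w) j := dotProduct_comm _ _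
  ext i j
  rw [mul_apply']
  fin_cases i
  · exact h u j
  · exact h v j
  · exact (h (u ⨯₃ v) j).trans (congrFun (hg.mulVec_cross u v) j)

/-- Two pairs of vectors in `ℝ³` with the same Gram matrix, the first of which is linearly
independent, are related by a unique rotation. -/
lemma existsUnique_isSO_mulVec_eq {u v u' v' : Fin 3 → ℝ} (h : LinearIndependent ℝ ![u, v])
    (huu : u ⬝ᵥ u = u' ⬝ᵥ u') (hvv : v ⬝ᵥ v = v' ⬝ᵥ v') (huv : u ⬝ᵥ v = u' ⬝ᵥ v') :
    ∃! g : Matrix (Fin 3) (Fin 3) ℝ, IsSO 3 g ∧ g *ᵥ u = u' ∧ g *ᵥ v = v' := by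
  have hdet := crossFrame_det_ne_zero h
  have hunit : IsUnit (crossFrame u v).det := hdet.isUnit
  have hgram : crossFrame u v * (crossFrame u v)ᵀ = crossFrame u' v' * (crossFrame u' v')ᵀ := by
    rw [_root_.crossFrame_mul_transpose, _root_.crossFrame_mul_transpose, huu, hvv, huv]
  have hdet' : (crossFrame u' v').det = (crossFrame u v).det := by
    rw [crossFrame_det, crossFrame_det, dotProduct_comm v u, dotProduct_comm v' u', huu, hvv, huv]
  refine ⟨((crossFrame u v)⁻¹ * crossFrame u' v')ᵀ, ⟨⟨?_, ?_⟩, ?_⟩, ?_⟩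
  · rw [transpose_transpose, transpose_mul, Matrix.mul_assoc,
      ← Matrix.mul_assoc (crossFrame u' v'), ← hgram, Matrix.mul_assoc, ← transpose_mul,
      nonsing_inv_mul _ hunit, transpose_one, Matrix.mul_one, nonsing_inv_mul _ hunit]
  · rw [det_transpose, det_mul, hdet', ← det_mul, nonsing_inv_mul _ hunit, det_one]
  · have hmul : crossFrame u v * ((crossFrame u v)⁻¹ * crossFrame u' v') = crossFrame u' v' :=
      mul_nonsing_inv_cancel_left _ _ hunit
    simp only [mulVec_transpose]
    exact ⟨congrFun hmul 0, congrFun hmul 1⟩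
  · rintro g ⟨hg, rfl, rfl⟩
    rw [← hg.crossFrame_mul_transpose, nonsing_inv_mul_cancel_left _ _ hunit, transpose_transpose]

theorem stmt_8 (x y x' y' : EuclideanSpace ℝ (Fin 3))
    (h : LinearIndependent ℝ ![x, y]) (h' : LinearIndependent ℝ ![x', y'])
    (hx : ‖x‖ = ‖x'‖) (hy : ‖y‖ = ‖y'‖) (hxy : ⟪x, y⟫ = ⟪x', y'⟫) :
    ∃! g : Matrix (Fin 3) (Fin 3) ℝ, IsSO 3 g ∧ g.mulVec x = x' ∧ g.mulVec y = y' := by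
  have hinner (a b : EuclideanSpace ℝ (Fin 3)) : ⟪a, b⟫ = a.ofLp ⬝ᵥ b.ofLp := by
    rw [EuclideanSpace.inner_eq_star_dotProduct, star_trivial, dotProduct_comm]
  have hself {a b : EuclideanSpace ℝ (Fin 3)} (hab : ‖a‖ = ‖b‖) :
      a.ofLp ⬝ᵥ a.ofLp = b.ofLp ⬝ᵥ b.ofLp := by
    rw [← hinner, ← hinner, real_inner_self_eq_norm_sq, real_inner_self_eq_norm_sq, hab]
  have hlin : LinearIndependent ℝ ![x.ofLp, y.ofLp] := by
    rw [LinearIndependent.pair_iff] at h ⊢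
    exact fun s t hst => h s t (WithLp.ofLp_injective 2 hst)
  rw [hinner, hinner] at hxy
  exact existsUnique_isSO_mulVec_eq hlin (hself hx) (hself hy) hxy

end
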